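/- arXiv:1807.08052 — 2 statements merged into one kernel-verified Lean document; each statement's English description precedes it below -/
import Mathlib

section
/- Assume hypotheses (H1), (H2), (H4) and (H5). Then the set Σ′ := {x ∈ K^r : R_1(x) = ⋯ = R_m(x) = 0 and the m×r Jacobian matrix ((∂R_i/∂X_j)(x))_{1≤i≤m,1≤j≤r} has rank strictly less than m} has dimension at most r−m−2; in particular Σ′ has codimension at least 2 in the variety V := {x ∈ K^r : R_1(x)=⋯=R_m(x)=0}. -/
open MvPolynomial Polynomial
open scoped Classical

noncomputable section

/-- The monic polynomial `T^r + a_{r-1} T^{r-1} + ⋯ + a_0` attached to a coefficient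
vector `a : Fin r → K` (where `a j` is the coefficient of `T^j`). -/
def monicOfCoeffs {K : Type*} [CommRing K] (r : ℕ) (a : Fin r → K) : Polynomial K :=
  Polynomial.X ^ r + ∑ j : Fin r, Polynomial.C (a j) * Polynomial.X ^ (j : ℕ)

/-- The vanishing ideal of a subset `Z ⊆ K^r`. -/
def vanishingIdealOf (K : Type*) [CommRing K] (r : ℕ) (Z : Set (Fin r → K)) :
    Ideal (MvPolynomial (Fin r) K) where
  carrier := {p | ∀ x ∈ Z, MvPolynomial.eval x p = 0}
  add_mem' := by
    intro a b ha hb x hx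
    simp [map_add, ha x hx, hb x hx]
  zero_mem' := by intro x hx; simp
  smul_mem' := by
    intro c p hp x hx
    simp [smul_eq_mul, map_mul, hp x hx]

/-- The dimension of a subset `Z ⊆ K^r`: the Krull dimension of the quotient of the
polynomial ring over `K` by the vanishing ideal of `Z`. -/
def dimOf (K : Type*) [CommRing K] (r : ℕ) (Z : Set (Fin r → K)) : WithBot ℕ∞ :=
  ringKrullDim (MvPolynomial (Fin r) K ⧸ vanishingIdealOf K r Z)

/-- `f` has factorization pattern `λ = (λ_1, …, λ_r)`: for each `i`, exactly `λ_i` of the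
monic irreducible factors of `f` over `F_q` (counted with multiplicity) have degree `i`.
(The index `i : Fin r` corresponds to the degree `i + 1`.) -/
def HasFactorizationPattern {Fq : Type*} [Field Fq] {r : ℕ}
    (f : Polynomial Fq) (lam : Fin r → ℕ) : Prop :=
  ∀ i : Fin r,
    ((UniqueFactorizationMonoid.normalizedFactors f).filter
      (fun g => g.natDegree = (i : ℕ) + 1)).card = lam i

end

noncomputable section

/-- The non-leading coefficients of the monic polynomial `∏ i, (T - x i)`. -/
def coeffsOfRoots {R : Type*} [CommRing R] {r : ℕ} (x : Fin r → R) (j : Fin r) : R :=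
  (∏ i, (Polynomial.X - Polynomial.C (x i))).coeff j

end

theorem monicOfCoeffs_coeffsOfRoots {R : Type*} [CommRing R] {r : ℕ} (x : Fin r → R) :
    monicOfCoeffs r (coeffsOfRoots x) = ∏ i, (Polynomial.X - Polynomial.C (x i)) := by
  nontriviality R
  have hmonic : (∏ i, (Polynomial.X - Polynomial.C (x i))).Monic :=
    Polynomial.monic_prod_of_monic _ _ fun i _ => Polynomial.monic_X_sub_C (x i)
  have hdeg : (∏ i, (Polynomial.X - Polynomial.C (x i))).natDegree = r := by
    rw [Polynomial.natDegree_prod_of_monic _ _ fun i _ => Polynomial.monic_X_sub_C (x i)]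
    simp
  conv_rhs => rw [hmonic.as_sum, hdeg]
  rw [monicOfCoeffs, Finset.sum_range]
  rfl

theorem map_coeffsOfRoots {R S : Type*} [CommRing R] [CommRing S] {r : ℕ} (f : R →+* S)
    (x : Fin r → R) (j : Fin r) : f (coeffsOfRoots x j) = coeffsOfRoots (fun i => f (x i)) j := by
  simp [coeffsOfRoots, ← Polynomial.coeff_map, Polynomial.map_prod]

theorem map_monicOfCoeffs {R S : Type*} [CommRing R] [CommRing S] {r : ℕ} (f : R →+* S)
    (a : Fin r → R) :
    (monicOfCoeffs r a).map f = monicOfCoeffs r (fun j => f (a j)) := by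
  simp [monicOfCoeffs, Polynomial.map_sum]

theorem monic_monicOfCoeffs {R : Type*} [CommRing R] {r : ℕ} (a : Fin r → R) :
    (monicOfCoeffs r a).Monic := by
  nontriviality R
  refine Polynomial.monic_X_pow_add ?_
  refine (Polynomial.degree_sum_le _ _).trans_lt ?_
  refine (Finset.sup_lt_iff (WithBot.bot_lt_coe r)).2 fun j _ => ?_
  exact (Polynomial.degree_C_mul_X_pow_le _ _).trans_lt (WithBot.coe_lt_coe.2 j.2)

theorem coeffsOfRoots_X {R : Type*} [CommRing R] {r : ℕ} (j : Fin r) :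
    coeffsOfRoots (MvPolynomial.X : Fin r → MvPolynomial (Fin r) R) j =
      (-1) ^ (r - (j : ℕ)) * MvPolynomial.esymm (Fin r) R (r - (j : ℕ)) := by
  rw [MvPolynomial.esymm_eq_multiset_esymm, coeffsOfRoots]
  have h := Multiset.prod_X_sub_C_coeff
    (Finset.univ.val.map (MvPolynomial.X : Fin r → MvPolynomial (Fin r) R)) (k := j) (by simp)
  rw [Multiset.map_map] at h
  simp only [Multiset.card_map, Finset.card_val, Finset.card_univ, Fintype.card_fin] at h
  exact h

/-- The Krull dimension does not increase along an integral ring homomorphism. -/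
theorem RingHom.IsIntegral.ringKrullDim_le {A B : Type*} [CommRing A] [CommRing B] {f : A →+* B}
    (hf : f.IsIntegral) : ringKrullDim B ≤ ringKrullDim A := by
  algebraize [f]
  refine Order.krullDim_le_of_strictMono (PrimeSpectrum.comap f) fun P Q h => ?_
  exact Ideal.IsIntegral.comap_lt_comap (R := A) (A := B) (I := P.asIdeal) (J := Q.asIdeal) h

theorem isIntegral_aeval_coeffsOfRoots (K : Type*) [CommRing K] (r : ℕ) :
    (MvPolynomial.aeval (coeffsOfRoots (MvPolynomial.X : Fin r → MvPolynomial (Fin r) K)) :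
      MvPolynomial (Fin r) K →ₐ[K] MvPolynomial (Fin r) K).toRingHom.IsIntegral := by
  intro p
  set f := (MvPolynomial.aeval (coeffsOfRoots (MvPolynomial.X : Fin r → MvPolynomial (Fin r) K)) :
      MvPolynomial (Fin r) K →ₐ[K] MvPolynomial (Fin r) K).toRingHom with hf
  induction p using MvPolynomial.induction_on with
  | C a =>
    have : MvPolynomial.C a = f (MvPolynomial.C a) := by simp [hf]
    rw [this]
    exact f.isIntegralElem_map
  | add p q hp hq => exact hp.add f hq
  | mul_X p i hp =>
    refine hp.mul f ⟨monicOfCoeffs r MvPolynomial.X, monic_monicOfCoeffs _, ?_⟩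
    rw [Polynomial.eval₂_eq_eval_map, map_monicOfCoeffs]
    have : (fun j => f (MvPolynomial.X j)) = coeffsOfRoots MvPolynomial.X := by
      ext1 j; simp [hf]
    rw [this, monicOfCoeffs_coeffsOfRoots, Polynomial.eval_prod]
    exact Finset.prod_eq_zero (Finset.mem_univ i) (by simp)

/-- A set of root vectors has dimension at most that of any set containing the corresponding
coefficient vectors. -/
theorem dimOf_le_of_mapsTo_coeffsOfRoots {K : Type*} [CommRing K] {r : ℕ}
    {S B : Set (Fin r → K)} (h : Set.MapsTo coeffsOfRoots S B) : dimOf K r S ≤ dimOf K r B := by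
  set f := (MvPolynomial.aeval (coeffsOfRoots (MvPolynomial.X : Fin r → MvPolynomial (Fin r) K)) :
      MvPolynomial (Fin r) K →ₐ[K] MvPolynomial (Fin r) K).toRingHom with hf
  have heval (x : Fin r → K) (p : MvPolynomial (Fin r) K) :
      MvPolynomial.eval x (f p) = MvPolynomial.eval (coeffsOfRoots x) p := by
    have : (MvPolynomial.eval x).comp f = MvPolynomial.eval (coeffsOfRoots x) := by
      apply MvPolynomial.ringHom_ext
      · simp [hf]
      · intro j
        simp [hf, map_coeffsOfRoots]
    exact RingHom.congr_fun this p
  have hle : vanishingIdealOf K r B ≤ (vanishingIdealOf K r S).comap f := by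
    intro p hp x hx
    rw [heval]
    exact hp _ (h hx)
  refine RingHom.IsIntegral.ringKrullDim_le (f := Ideal.quotientMap _ f hle) ?_
  refine RingHom.IsIntegral.tower_top (Ideal.Quotient.mk _) _ ?_
  rw [Ideal.quotientMap_comp_mk]
  exact RingHom.IsIntegral.trans _ _ (isIntegral_aeval_coeffsOfRoots K r)
    (RingHom.isIntegral_of_surjective _ Ideal.Quotient.mk_surjective)

theorem vanishingIdealOf_eq {K : Type*} [Field K] {r : ℕ} (Z : Set (Fin r → K)) :
    vanishingIdealOf K r Z = MvPolynomial.vanishingIdeal K Z := by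
  ext p
  simp only [MvPolynomial.mem_vanishingIdeal_iff, MvPolynomial.aeval_eq_eval]
  rfl

/-- Over an algebraically closed field, the maximal ideal of every point of affine `r`-space
has height `r`. -/
theorem height_vanishingIdeal_singleton {K : Type*} [Field K] [IsAlgClosed K] {r : ℕ}
    (x : Fin r → K) : (MvPolynomial.vanishingIdeal K {x}).height = r := by
  have hdim : ringKrullDim (MvPolynomial (Fin r) K) = r := by simp
  have : FiniteRingKrullDim (MvPolynomial (Fin r) K) := by
    rw [finiteRingKrullDim_iff_ne_bot_and_top, hdim]
    exact ⟨WithBot.coe_ne_bot, fun h => ENat.natCast_ne_top r (WithBot.coe_injective h)⟩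
  obtain ⟨P, hP, hPh⟩ := Ideal.exists_isMaximal_height (R := MvPolynomial (Fin r) K)
  obtain ⟨y, rfl⟩ := MvPolynomial.isMaximal_iff_eq_vanishingIdeal_singleton.1 hP
  rw [hdim] at hPh
  let g (z : Fin r → K) : MvPolynomial (Fin r) K →ₐ[K] MvPolynomial (Fin r) K :=
    MvPolynomial.aeval fun i => MvPolynomial.X i + MvPolynomial.C (z i)
  have hg (z w : Fin r → K) (hzw : z + w = 0) : (g z).comp (g w) = AlgHom.id K _ := by
    ext1 i
    have : z i + w i = 0 := congrFun hzw i
    simp [g, add_assoc, ← MvPolynomial.C_add, this, -MvPolynomial.aeval_eq_bind₁]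
  let e : MvPolynomial (Fin r) K ≃ₐ[K] MvPolynomial (Fin r) K :=
    AlgEquiv.ofAlgHom (g (x - y)) (g (y - x)) (hg _ _ (by simp)) (hg _ _ (by simp))
  have he : (MvPolynomial.vanishingIdeal K {x}) =
      (MvPolynomial.vanishingIdeal K {y}).comap e.toRingEquiv := by
    ext p
    rw [Ideal.mem_comap, MvPolynomial.mem_vanishingIdeal_singleton_iff,
      MvPolynomial.mem_vanishingIdeal_singleton_iff]
    have : (MvPolynomial.aeval y : MvPolynomial (Fin r) K →ₐ[K] K).comp (g (x - y)) =
        MvPolynomial.aeval x := by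
      ext1 i
      simp [g]
    rw [← this]
    rfl
  rw [he, RingEquiv.height_comap]
  exact_mod_cast hPh

theorem le_dimOf_add_of_mem {K : Type*} [Field K] [IsAlgClosed K] {r m : ℕ}
    (F : Fin m → MvPolynomial (Fin r) K) (x : Fin r → K)
    (hx : ∀ i, MvPolynomial.eval x (F i) = 0) :
    (r : WithBot ℕ∞) ≤ dimOf K r {y | ∀ i, MvPolynomial.eval y (F i) = 0} + m := by
  have hV : {y | ∀ i, MvPolynomial.eval y (F i) = 0} =
      MvPolynomial.zeroLocus K (Ideal.span (Set.range F)) := by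
    rw [MvPolynomial.zeroLocus_span]
    ext y
    simp
  rw [dimOf, vanishingIdealOf_eq, hV, MvPolynomial.vanishingIdeal_zeroLocus_eq_radical,
    ringKrullDim_quotient, PrimeSpectrum.zeroLocus_radical, ← ringKrullDim_quotient]
  have hmax : (MvPolynomial.vanishingIdeal K {x}).IsMaximal :=
    MvPolynomial.isMaximal_iff_eq_vanishingIdeal_singleton.2 ⟨x, rfl⟩
  have h := Ideal.height_le_ringKrullDim_quotient_add_encard
    (p := MvPolynomial.vanishingIdeal K {x}) (Set.range F) (by
      rintro _ ⟨i, rfl⟩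
      exact (MvPolynomial.mem_vanishingIdeal_singleton_iff x _).2 (by simpa using hx i))
  rw [height_vanishingIdeal_singleton] at h
  refine le_trans (by exact_mod_cast h) (add_le_add_right ?_ _)
  have hc : (Set.range F).encard ≤ (m : ℕ∞) := by
    rw [← Set.image_univ]
    exact (Set.encard_image_le _ _).trans (by simp)
  exact_mod_cast hc

/-- The chain rule for polynomial substitution. -/
theorem MvPolynomial.pderiv_aeval {R σ τ : Type*} [CommSemiring R] [Fintype σ]
    (g : σ → MvPolynomial τ R) (p : MvPolynomial σ R) (j : τ) :
    MvPolynomial.pderiv j (MvPolynomial.aeval g p) =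
      ∑ l, MvPolynomial.aeval g (MvPolynomial.pderiv l p) * MvPolynomial.pderiv j (g l) := by
  induction p using MvPolynomial.induction_on with
  | C a => simp
  | add p q hp hq => simp only [map_add, hp, hq, add_mul, Finset.sum_add_distrib]
  | mul_X p i hp =>
    classical
    simp [hp, add_mul, Finset.sum_add_distrib, Pi.single_apply, Finset.mul_sum, mul_assoc,
      apply_ite, -MvPolynomial.aeval_eq_bind₁]

theorem pderiv_coeff_prod_X_sub_C {R σ : Type*} [CommRing R] (j : σ) (s : Finset σ)
    (hj : j ∉ s) (n : ℕ) :
    MvPolynomial.pderiv j ((∏ i ∈ s, (Polynomial.X - Polynomial.C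
      (MvPolynomial.X i : MvPolynomial σ R))).coeff n) = 0 := by
  classical
  induction s using Finset.induction_on generalizing n with
  | empty => simp [Polynomial.coeff_one, apply_ite]
  | insert a s ha ih =>
    rw [Finset.mem_insert, not_or] at hj
    rw [Finset.prod_insert ha, sub_mul, Polynomial.coeff_sub, Polynomial.coeff_C_mul, map_sub,
      MvPolynomial.pderiv_mul, ih hj.2, MvPolynomial.pderiv_X_of_ne (Ne.symm hj.1)]
    cases n with
    | zero => simp
    | succ n => simp [Polynomial.coeff_X_mul, ih hj.2]

theorem pderiv_coeffsOfRoots {R : Type*} [CommRing R] {r : ℕ} (j l : Fin r) :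
    MvPolynomial.pderiv j (coeffsOfRoots
      (MvPolynomial.X : Fin r → MvPolynomial (Fin r) R) l) =
      -(∏ i ∈ Finset.univ.erase j, (Polynomial.X - Polynomial.C
        (MvPolynomial.X i : MvPolynomial (Fin r) R))).coeff l := by
  rw [coeffsOfRoots, ← Finset.mul_prod_erase _ _ (Finset.mem_univ j), sub_mul,
    Polynomial.coeff_sub, Polynomial.coeff_C_mul, map_sub, MvPolynomial.pderiv_mul,
    pderiv_coeff_prod_X_sub_C _ _ (Finset.notMem_erase _ _)]
  have h : MvPolynomial.pderiv j ((Polynomial.X * ∏ i ∈ Finset.univ.erase j,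
      (Polynomial.X - Polynomial.C (MvPolynomial.X i : MvPolynomial (Fin r) R))).coeff l) = 0 := by
    cases (l : ℕ) with
    | zero => simp
    | succ n =>
      rw [Polynomial.coeff_X_mul, pderiv_coeff_prod_X_sub_C _ _ (Finset.notMem_erase _ _)]
  simp [h]

/-- A linear functional killing all `∏_{i ≠ j} (T - x i)` kills all multiples of `T - x b` of
small degree, provided the `x i` with `i ≠ b` are distinct. -/
theorem map_X_sub_C_mul_eq_zero {K ι : Type*} [Field K] [Fintype ι] [DecidableEq ι]
    (x : ι → K) (b : ι) (hinj : Set.InjOn x (Finset.univ.erase b : Finset ι))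
    (L : Polynomial K →ₗ[K] K)
    (hL : ∀ j, L (∏ i ∈ Finset.univ.erase j, (Polynomial.X - Polynomial.C (x i))) = 0)
    (q : Polynomial K) (hq : q.degree < (Finset.univ.erase b : Finset ι).card) :
    L ((Polynomial.X - Polynomial.C (x b)) * q) = 0 := by
  rw [Lagrange.eq_interpolate hinj hq, Lagrange.interpolate_apply, Finset.mul_sum, map_sum]
  refine Finset.sum_eq_zero fun j hj => ?_
  have hprod : (Polynomial.X - Polynomial.C (x b)) *
      ∏ i ∈ (Finset.univ.erase b).erase j, (Polynomial.X - Polynomial.C (x i)) =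
      ∏ i ∈ Finset.univ.erase j, (Polynomial.X - Polynomial.C (x i)) := by
    rw [Finset.erase_right_comm]
    exact Finset.mul_prod_erase _ (fun i => Polynomial.X - Polynomial.C (x i))
      (by simpa using (Finset.ne_of_mem_erase hj).symm)
  simp only [Lagrange.basis, Lagrange.basisDivisor, Finset.prod_mul_distrib]
  rw [← map_prod, mul_left_comm, mul_left_comm _ (Polynomial.C _), hprod,
    ← Polynomial.smul_eq_C_mul, ← Polynomial.smul_eq_C_mul, map_smul, map_smul, hL]
  simp

/-- The `r - 1` rows `l ≠ k` of the Jacobian of `coeffsOfRoots` are linearly independent at any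
point that has a nonzero coordinate outside of which all coordinates are distinct. -/
theorem eq_zero_of_sum_mul_coeff_eq_zero {K : Type*} [Field K] {r : ℕ} (k : Fin r)
    (x : Fin r → K) (b : Fin r) (hb : x b ≠ 0)
    (hinj : Set.InjOn x (Finset.univ.erase b : Finset (Fin r)))
    (w : {l : Fin r // l ≠ k} → K)
    (hw : ∀ j, ∑ l, w l *
      (∏ i ∈ Finset.univ.erase j, (Polynomial.X - Polynomial.C (x i))).coeff l.1 = 0) :
    w = 0 := by
  let L : Polynomial K →ₗ[K] K := ∑ l : {l : Fin r // l ≠ k}, w l • Polynomial.lcoeff K l.1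
  have hL (p : Polynomial K) : L p = ∑ l, w l * p.coeff l.1 := by simp [L]
  have hstep (n : ℕ) (hn : n + 1 < r) :
      L (Polynomial.X ^ (n + 1)) = x b * L (Polynomial.X ^ n) := by
    have h := map_X_sub_C_mul_eq_zero x b hinj L (fun j => by rw [hL, hw]) (Polynomial.X ^ n) (by
      rw [Polynomial.degree_X_pow]
      simp only [Finset.card_erase_of_mem (Finset.mem_univ b), Finset.card_univ, Fintype.card_fin]
      exact_mod_cast Nat.lt_sub_of_add_lt hn)
    rw [sub_mul, ← pow_succ', map_sub, ← Polynomial.smul_eq_C_mul, map_smul] at h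
    simpa [sub_eq_zero] using h
  have hpow (n : ℕ) (hn : n < r) : L (Polynomial.X ^ n) = x b ^ n * L 1 := by
    induction n with
    | zero => simp
    | succ n ih => rw [hstep n hn, ih (by omega), pow_succ', mul_assoc]
  have hk : L (Polynomial.X ^ (k : ℕ)) = 0 := by
    rw [hL]
    refine Finset.sum_eq_zero fun l _ => ?_
    rw [Polynomial.coeff_X_pow, if_neg (fun h => l.2 (Fin.ext h)), mul_zero]
  have h1 : L 1 = 0 := by
    rw [hpow k k.2] at hk
    exact (mul_eq_zero.1 hk).resolve_left (pow_ne_zero _ hb)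
  ext l
  have hl := hpow l.1 l.1.2
  rw [h1, mul_zero, hL, Finset.sum_eq_single l] at hl
  · simpa using hl
  · intro l' _ hne
    rw [Polynomial.coeff_X_pow, if_neg (fun h => hne (Subtype.ext (Fin.ext h))), mul_zero]
  · simp

/-- Right multiplication by a matrix with linearly independent rows preserves the rank. -/
theorem Matrix.rank_mul_eq_left_of_vecMul_eq_zero {K l m n : Type*} [Field K] [Fintype l]
    [Fintype m] [Fintype n] (A : Matrix l m K) (B : Matrix m n K)
    (hB : ∀ w, Matrix.vecMul w B = 0 → w = 0) : (A * B).rank = A.rank := by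
  have hinj : Function.Injective B.transpose.mulVecLin := by
    rw [injective_iff_map_eq_zero]
    intro w hw
    exact hB w (by simpa [Matrix.mulVec_transpose] using hw)
  rw [← Matrix.rank_transpose (A * B), ← Matrix.rank_transpose A, Matrix.transpose_mul,
    Matrix.rank, Matrix.mulVecLin_mul, LinearMap.range_comp]
  exact (Submodule.equivMapOfInjective _ hinj _).finrank_eq.symm

theorem exists_ne_zero_injOn_or_degenerate {K : Type*} [Field K] {r : ℕ} (hr : 2 ≤ r)
    (x : Fin r → K) :
    (∃ b, x b ≠ 0 ∧ Set.InjOn x (Finset.univ.erase b : Finset (Fin r))) ∨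
    (¬ Squarefree (∏ i, (Polynomial.X - Polynomial.C (x i))) ∧ ∃ i, x i = 0) ∨
    ∃ u : Polynomial K, u.degree = 2 ∧ u ∣ ∏ i, (Polynomial.X - Polynomial.C (x i)) ∧
      u ∣ Polynomial.derivative (∏ i, (Polynomial.X - Polynomial.C (x i))) := by
  have hdvd (s : Finset (Fin r)) : ∏ i ∈ s, (Polynomial.X - Polynomial.C (x i)) ∣
      ∏ i, (Polynomial.X - Polynomial.C (x i)) :=
    Finset.prod_dvd_prod_of_subset _ _ _ (Finset.subset_univ s)
  by_cases hinj : Function.Injective x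
  · left
    by_cases h0 : x ⟨0, by omega⟩ = 0
    · refine ⟨⟨1, by omega⟩, fun h1 => ?_, hinj.injOn⟩
      simpa using hinj (h0.trans h1.symm)
    · exact ⟨_, h0, hinj.injOn⟩
  · obtain ⟨a, b, hxab, hab⟩ : ∃ a b, x a = x b ∧ a ≠ b := by
      simpa [Function.Injective] using hinj
    by_cases h0 : ∃ i, x i = 0
    · refine Or.inr (Or.inl ⟨fun hsq => ?_, h0⟩)
      have h := hdvd {a, b}
      rw [Finset.prod_pair hab, hxab] at h
      exact Polynomial.not_isUnit_X_sub_C _ (hsq _ h)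
    push Not at h0
    by_cases hb : Set.InjOn x (Finset.univ.erase b : Finset (Fin r))
    · exact Or.inl ⟨b, h0 b, hb⟩
    refine Or.inr (Or.inr ?_)
    obtain ⟨c, hc, d, hd, hxcd, hcd⟩ : ∃ c, c ≠ b ∧ ∃ d, d ≠ b ∧ x c = x d ∧ c ≠ d := by
      simpa [Set.InjOn] using hb
    have htriple (e : Fin r) (hxe : x e = x b) (hea : e ≠ a) (heb : e ≠ b) :
        (Polynomial.X - Polynomial.C (x b)) ^ 3 ∣
          ∏ i, (Polynomial.X - Polynomial.C (x i)) := by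
      convert hdvd {e, a, b} using 1
      rw [Finset.prod_insert (by simp [hea, heb]), Finset.prod_pair hab, hxe, hxab]
      ring
    have hof_triple (h : (Polynomial.X - Polynomial.C (x b)) ^ 3 ∣
          ∏ i, (Polynomial.X - Polynomial.C (x i))) :
        ∃ u : Polynomial K, u.degree = 2 ∧ u ∣ ∏ i, (Polynomial.X - Polynomial.C (x i)) ∧
          u ∣ Polynomial.derivative (∏ i, (Polynomial.X - Polynomial.C (x i))) :=
      ⟨(Polynomial.X - Polynomial.C (x b)) ^ 2, by simp [Polynomial.degree_pow],
        (pow_dvd_pow _ (Nat.le_succ 2)).trans h,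
        Polynomial.pow_sub_one_dvd_derivative_of_pow_dvd (n := 3) h⟩
    by_cases hca : c = a
    · subst hca
      exact hof_triple (htriple d (hxcd.symm.trans hxab) hcd.symm hd)
    by_cases hda : d = a
    · subst hda
      exact hof_triple (htriple c (hxcd.trans hxab) hcd hc)
    have hquad : ((Polynomial.X - Polynomial.C (x b)) * (Polynomial.X - Polynomial.C (x d))) ^ 2 ∣
        ∏ i, (Polynomial.X - Polynomial.C (x i)) := by
      convert hdvd {c, d, a, b} using 1
      rw [Finset.prod_insert (by simp [hcd, hca, hc]), Finset.prod_insert (by simp [hda, hd]),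
        Finset.prod_pair hab, hxcd, hxab]
      ring
    refine ⟨(Polynomial.X - Polynomial.C (x b)) * (Polynomial.X - Polynomial.C (x d)), ?_,
      (dvd_pow_self _ two_ne_zero).trans hquad, by
      simpa using Polynomial.pow_sub_one_dvd_derivative_of_pow_dvd hquad⟩
    rw [Polynomial.degree_mul, Polynomial.degree_X_sub_C, Polynomial.degree_X_sub_C]
    rfl

theorem MvPolynomial.map_aeval_eq_aeval_map {F K σ τ : Type*} [CommSemiring F] [CommSemiring K]
    (f : F →+* K) (g : σ → MvPolynomial τ F) (p : MvPolynomial σ F) :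
    MvPolynomial.map f (MvPolynomial.aeval g p) =
      MvPolynomial.aeval (fun l => MvPolynomial.map f (g l)) (MvPolynomial.map f p) := by
  induction p using MvPolynomial.induction_on with
  | C a => simp
  | add p q hp hq => simp only [map_add, hp, hq]
  | mul_X p i hp => simp only [map_mul, hp, MvPolynomial.aeval_X, MvPolynomial.map_X]

theorem eval_aeval_coeffsOfRoots {K : Type*} [CommRing K] {r : ℕ} (s : Set (Fin r))
    (x : Fin r → K) (p : MvPolynomial s K) :
    MvPolynomial.eval x (MvPolynomial.aeval (fun l : s => coeffsOfRoots MvPolynomial.X l.1) p) =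
      MvPolynomial.eval (fun l : s => coeffsOfRoots x l.1) p := by
  induction p using MvPolynomial.induction_on with
  | C a => simp
  | add p q hp hq => simp only [map_add, hp, hq]
  | mul_X p i hp =>
    simp only [map_mul, hp, MvPolynomial.aeval_X, map_coeffsOfRoots, MvPolynomial.eval_X]

/-- The Jacobian matrix, at a root vector, of polynomials in the coefficients other than the
`k`-th has the same rank as the Jacobian matrix in the coefficients, if some nonzero coordinate
can be removed to make the remaining ones distinct. -/
theorem rank_jacobian_aeval_coeffsOfRoots {K : Type*} [Field K] {r m : ℕ} (k : Fin r)
    (G : Fin m → MvPolynomial {j : Fin r // j ≠ k} K) (x : Fin r → K) (b : Fin r) (hb : x b ≠ 0)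
    (hinj : Set.InjOn x (Finset.univ.erase b : Finset (Fin r))) :
    (Matrix.of fun (i : Fin m) (j : Fin r) => MvPolynomial.eval x (MvPolynomial.pderiv j
      (MvPolynomial.aeval
        (fun l : {j : Fin r // j ≠ k} => coeffsOfRoots MvPolynomial.X l.1) (G i)))).rank =
    (Matrix.of fun (i : Fin m) (l : {j : Fin r // j ≠ k}) =>
      MvPolynomial.eval (fun l : {j : Fin r // j ≠ k} => coeffsOfRoots x l.1)
        (MvPolynomial.pderiv l (G i))).rank := by
  let D : Matrix {j : Fin r // j ≠ k} (Fin r) K := Matrix.of fun l j =>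
    -(∏ i ∈ Finset.univ.erase j, (Polynomial.X - Polynomial.C (x i))).coeff l.1
  have hD (l : {j : Fin r // j ≠ k}) (j : Fin r) : MvPolynomial.eval x (MvPolynomial.pderiv j
      (coeffsOfRoots MvPolynomial.X l.1)) = D l j := by
    rw [pderiv_coeffsOfRoots, map_neg, ← Polynomial.coeff_map, Polynomial.map_prod]
    simp [D]
  rw [← Matrix.rank_mul_eq_left_of_vecMul_eq_zero _ D]
  · congr 1
    ext i j
    simp only [Matrix.of_apply, Matrix.mul_apply, MvPolynomial.pderiv_aeval, map_sum, map_mul, hD]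
    refine Finset.sum_congr rfl fun l _ => ?_
    congr 1
    exact eval_aeval_coeffsOfRoots {j | j ≠ k} x _
  · intro w hw
    refine eq_zero_of_sum_mul_coeff_eq_zero k x b hb hinj w fun j => ?_
    simpa [D, Matrix.vecMul, dotProduct] using congrFun hw j

theorem dimOf_empty (K : Type*) [CommRing K] (r : ℕ) : dimOf K r ∅ = ⊥ := by
  have h : vanishingIdealOf K r ∅ = ⊤ := (Ideal.eq_top_iff_one _).2 fun x hx => hx.elim
  rw [dimOf, h]
  exact ringKrullDim_eq_bot_of_subsingleton

theorem natCast_sub_le_of_le_add {r m : ℕ} {d : WithBot ℕ∞} (h : (r : WithBot ℕ∞) ≤ d + m) :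
    ((r - m : ℕ) : WithBot ℕ∞) ≤ d := by
  induction d with
  | bot => simp at h
  | coe d =>
    induction d with
    | top => exact_mod_cast le_top
    | coe d =>
      have hd : r ≤ d + m := by exact_mod_cast h
      have hd' : r - m ≤ d := by omega
      exact WithBot.coe_le_coe.2 (ENat.natCast_le_natCast.2 hd')

/-- Under hypotheses (H1), (H2), (H4) and (H5), the locus of points of
`V = {R_1 = ⋯ = R_m = 0}` where the Jacobian of `R_1, …, R_m` fails to have full rank has
dimension at most `r - m - 2`; in particular it has codimension at least `2` in `V`. -/
theorem singular_locus_of_V_has_codimension_two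
    (Fq K : Type) [Field Fq] [Fintype Fq] [Field K] [Algebra Fq K] [IsAlgClosure Fq K]
    (r m : ℕ) (hm : 1 ≤ m) (hmr : m < r) (k : Fin r)
    (G : Fin m → MvPolynomial {j : Fin r // j ≠ k} Fq)
    -- the variety `W ⊆ K^r` of common zeros of `G_1, …, G_m`
    (W : Set (Fin r → K))
    (hW : W = {a | ∀ i, MvPolynomial.eval (fun j : {j : Fin r // j ≠ k} => a j.1)
        (MvPolynomial.map (algebraMap Fq K) (G i)) = 0})
    -- (H1): `G_1, …, G_m` form a regular sequence
    (hH1 : RingTheory.Sequence.IsRegular (MvPolynomial {j : Fin r // j ≠ k} Fq) (List.ofFn G))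
    -- (H2): the Jacobian of `G_1, …, G_m` has full rank `m` at every point of `W`
    (hH2 : ∀ a ∈ W, Matrix.rank (Matrix.of fun (i : Fin m) (j : {j : Fin r // j ≠ k}) =>
        MvPolynomial.eval (fun j' : {j : Fin r // j ≠ k} => a j'.1)
          (MvPolynomial.pderiv j (MvPolynomial.map (algebraMap Fq K) (G i)))) = m)
    -- (H4): the non-squarefree locus in `W` has dimension at most `r - m - 1`
    (hH4 : dimOf K r {a | a ∈ W ∧ ¬ Squarefree (monicOfCoeffs r a)} + 1
        ≤ ((r - m : ℕ) : WithBot ℕ∞))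
    -- (H5): dimension at most `r - m - 2`
    (hH5 : dimOf K r
        ({a | a ∈ W ∧ ¬ Squarefree (monicOfCoeffs r a)
            ∧ a ⟨0, lt_of_le_of_lt (Nat.zero_le m) hmr⟩ = 0}
          ∪ {a | a ∈ W ∧ 2 ≤ (EuclideanDomain.gcd (monicOfCoeffs r a)
              (Polynomial.derivative (monicOfCoeffs r a))).degree}) + 2
        ≤ ((r - m : ℕ) : WithBot ℕ∞))
    -- the polynomials `R_i`, obtained from `G_i` by substituting `(-1)^(r-j) Π_(r-j)` for `A_j`
    (R : Fin m → MvPolynomial (Fin r) Fq)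
    (hR : ∀ i, R i = MvPolynomial.aeval
        (fun j : {j : Fin r // j ≠ k} =>
          (-1 : MvPolynomial (Fin r) Fq) ^ (r - (j.1 : ℕ))
            * MvPolynomial.esymm (Fin r) Fq (r - (j.1 : ℕ))) (G i))
 :
    dimOf K r {x : Fin r → K |
        (∀ i, MvPolynomial.eval x (MvPolynomial.map (algebraMap Fq K) (R i)) = 0)
        ∧ Matrix.rank (Matrix.of fun (i : Fin m) (j : Fin r) =>
            MvPolynomial.eval x
              (MvPolynomial.pderiv j (MvPolynomial.map (algebraMap Fq K) (R i)))) < m} + 2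
      ≤ ((r - m : ℕ) : WithBot ℕ∞)
    ∧ dimOf K r {x : Fin r → K |
        (∀ i, MvPolynomial.eval x (MvPolynomial.map (algebraMap Fq K) (R i)) = 0)
        ∧ Matrix.rank (Matrix.of fun (i : Fin m) (j : Fin r) =>
            MvPolynomial.eval x
              (MvPolynomial.pderiv j (MvPolynomial.map (algebraMap Fq K) (R i)))) < m} + 2
      ≤ dimOf K r {x : Fin r → K |
          ∀ i, MvPolynomial.eval x (MvPolynomial.map (algebraMap Fq K) (R i)) = 0} := by
  have := IsAlgClosure.isAlgClosed Fq (K := K)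
  have hRmap (i : Fin m) : MvPolynomial.map (algebraMap Fq K) (R i) =
      MvPolynomial.aeval (fun l : {j : Fin r // j ≠ k} => coeffsOfRoots MvPolynomial.X l.1)
        (MvPolynomial.map (algebraMap Fq K) (G i)) := by
    rw [hR, MvPolynomial.map_aeval_eq_aeval_map]
    simp only [coeffsOfRoots_X, map_mul, map_pow, map_neg, map_one, MvPolynomial.map_esymm]
  have hle := dimOf_le_of_mapsTo_coeffsOfRoots (K := K) (r := r)
    (S := {x : Fin r → K |
        (∀ i, MvPolynomial.eval x (MvPolynomial.map (algebraMap Fq K) (R i)) = 0)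
        ∧ Matrix.rank (Matrix.of fun (i : Fin m) (j : Fin r) =>
            MvPolynomial.eval x
              (MvPolynomial.pderiv j (MvPolynomial.map (algebraMap Fq K) (R i)))) < m})
    (B := {a | a ∈ W ∧ ¬ Squarefree (monicOfCoeffs r a)
            ∧ a ⟨0, lt_of_le_of_lt (Nat.zero_le m) hmr⟩ = 0}
          ∪ {a | a ∈ W ∧ 2 ≤ (EuclideanDomain.gcd (monicOfCoeffs r a)
              (Polynomial.derivative (monicOfCoeffs r a))).degree}) (by
    rintro x ⟨hx, hrank⟩
    have hxW : coeffsOfRoots x ∈ W := by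
      rw [hW]
      intro i
      rw [← hx i, hRmap]
      exact (eval_aeval_coeffsOfRoots {j | j ≠ k} x _).symm
    simp only [Set.mem_union, Set.mem_ofPred_eq, monicOfCoeffs_coeffsOfRoots, hxW, true_and]
    rcases exists_ne_zero_injOn_or_degenerate (by omega) x with
      ⟨b, hb, hinj⟩ | ⟨hsq, i, hi⟩ | ⟨u, hu, huf, hufd⟩
    · simp only [hRmap] at hrank
      rw [rank_jacobian_aeval_coeffsOfRoots k _ x b hb hinj, hH2 _ hxW] at hrank
      exact absurd hrank (lt_irrefl m)
    · refine Or.inl ⟨hsq, ?_⟩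
      rw [coeffsOfRoots, Polynomial.coeff_zero_eq_eval_zero, Polynomial.eval_prod]
      exact Finset.prod_eq_zero (Finset.mem_univ i) (by simp [hi])
    · refine Or.inr ?_
      rw [← hu]
      refine Polynomial.degree_le_of_dvd (EuclideanDomain.dvd_gcd huf hufd) fun h => ?_
      exact Finset.prod_ne_zero_iff.2 (fun i _ => Polynomial.X_sub_C_ne_zero (x i))
        (EuclideanDomain.gcd_eq_zero_iff.1 h).1)
  have hdim := (add_le_add_left hle 2).trans hH5
  refine ⟨hdim, ?_⟩
  rcases Set.eq_empty_or_nonempty {x : Fin r → K |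
      (∀ i, MvPolynomial.eval x (MvPolynomial.map (algebraMap Fq K) (R i)) = 0)
      ∧ Matrix.rank (Matrix.of fun (i : Fin m) (j : Fin r) =>
          MvPolynomial.eval x
            (MvPolynomial.pderiv j (MvPolynomial.map (algebraMap Fq K) (R i)))) < m}
    with hempty | ⟨x, hx, -⟩
  · rw [hempty, dimOf_empty]
    simp
  · exact hdim.trans (natCast_sub_le_of_le_add (le_dimOf_add_of_mem _ x hx))
end

section
/- Assume hypotheses (H1), (H2), (H4) and (H5). Then the ideal generated by R_1,…,R_m in the polynomial ring K[X_1,…,X_r] is a radical ideal (so the affine variety V := {x ∈ K^r : R_1(x)=⋯=R_m(x)=0} is an ideal-theoretic complete intersection). -/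
open MvPolynomial Polynomial
open scoped Classical

open scoped TensorProduct in
/-- In a smooth algebra over an integrally closed domain `R`, every nilpotent element is divisible
by every nonzero element of `R`. -/
theorem exists_eq_smul_of_isNilpotent_of_smooth {R S : Type*} [CommRing R] [IsDomain R]
    [IsIntegrallyClosed R] [CommRing S] [Algebra R S] [Algebra.Smooth R S]
    {x : R} (hx : x ≠ 0) {n : S} (hn : IsNilpotent n) : ∃ s : S, n = x • s := by
  let F := FractionRing R
  have hbij := TensorProduct.toIntegralClosure_bijective_of_smooth (R := R) (S := S) (B := F)
  have hinj : Function.Injective (Algebra.TensorProduct.includeLeft : S →ₐ[R] S ⊗[R] F) :=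
    Algebra.TensorProduct.includeLeft_injective (IsFractionRing.injective R F)
  have ht : algebraMap R F x ≠ 0 := by simpa using hx
  obtain ⟨e, he⟩ := hn
  have hz : IsIntegral S (n ⊗ₜ[R] (algebraMap R F x)⁻¹) := by
    refine ⟨Polynomial.X ^ e, Polynomial.monic_X_pow e, ?_⟩
    rw [Polynomial.eval₂_X_pow, Algebra.TensorProduct.tmul_pow, he, TensorProduct.zero_tmul]
  obtain ⟨w, hw⟩ := hbij.2 ⟨_, hz⟩
  have hrange : ∀ w : S ⊗[R] integralClosure R F, ∃ s : S,
      ((TensorProduct.toIntegralClosure R S F w : integralClosure S (S ⊗[R] F)) :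
        S ⊗[R] F) = s ⊗ₜ[R] 1 := by
    intro w
    induction w with
    | zero => exact ⟨0, by simp⟩
    | add x y hx hy =>
      obtain ⟨a, ha⟩ := hx
      obtain ⟨b, hb⟩ := hy
      exact ⟨a + b, by simp [ha, hb, TensorProduct.add_tmul]⟩
    | tmul x y =>
      obtain ⟨c, hc⟩ := IsIntegrallyClosed.isIntegral_iff.mp y.2
      refine ⟨c • x, ?_⟩
      have : ((TensorProduct.toIntegralClosure R S F (x ⊗ₜ y) :
        integralClosure S (S ⊗[R] F)) : S ⊗[R] F) = x ⊗ₜ[R] (y : F) := rfl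
      rw [this, ← hc, Algebra.algebraMap_eq_smul_one, TensorProduct.tmul_smul,
        TensorProduct.smul_tmul']
  obtain ⟨s, hs⟩ := hrange w
  rw [hw] at hs
  refine ⟨s, hinj ?_⟩
  have h2 := congrArg (fun u => x • u) hs
  dsimp only at h2
  rwa [← TensorProduct.tmul_smul, Algebra.smul_def, mul_inv_cancel₀ ht,
    TensorProduct.smul_tmul'] at h2

open scoped TensorProduct in
/-- A smooth algebra over a field is reduced. -/
theorem isReduced_of_smooth_field (k S : Type*) [Field k] [CommRing S] [Algebra k S]
    [Algebra.Smooth k S] : IsReduced S := by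
  let ev : Polynomial k ⊗[k] S →ₐ[k] S :=
    Algebra.TensorProduct.lift ((Algebra.ofId k S).comp (Polynomial.aeval (0 : k)))
      (AlgHom.id k S) (fun _ _ => mul_comm _ _)
  refine ⟨fun n hn => ?_⟩
  have hn' : IsNilpotent ((1 : Polynomial k) ⊗ₜ[k] n) := by
    obtain ⟨e, he⟩ := hn
    exact ⟨e, by rw [Algebra.TensorProduct.tmul_pow, he, TensorProduct.tmul_zero]⟩
  obtain ⟨s, hs⟩ := exists_eq_smul_of_isNilpotent_of_smooth
    (Polynomial.X_ne_zero (R := k)) hn'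
  have hev : ∀ (p : Polynomial k) (a : S),
      ev (p ⊗ₜ[k] a) = algebraMap k S (Polynomial.aeval (0 : k) p) * a :=
    fun p a => Algebra.TensorProduct.lift_tmul _ _ _ _ _
  have h1 : ev ((1 : Polynomial k) ⊗ₜ[k] n) = n := by rw [hev, map_one, map_one, one_mul]
  rw [← h1, hs, Algebra.smul_def, map_mul, Algebra.TensorProduct.algebraMap_apply, hev]
  simp

/-- First order Taylor expansion along a square-zero perturbation. -/
theorem MvPolynomial.aeval_add_of_mul_eq_zero {k E σ : Type*} [CommRing k] [CommRing E]
    [Algebra k E] [Fintype σ] (x y : σ → E) (hy : ∀ i j, y i * y j = 0)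
    (p : MvPolynomial σ k) :
    MvPolynomial.aeval (fun j => x j + y j) p = MvPolynomial.aeval x p +
      ∑ j, MvPolynomial.aeval x (MvPolynomial.pderiv j p) * y j := by
  induction p using MvPolynomial.induction_on with
  | C a => simp
  | add p q hp hq =>
    simp only [map_add, hp, hq, add_mul, Finset.sum_add_distrib]
    ring
  | mul_X p i hp =>
    have h0 : (∑ j, MvPolynomial.aeval x (MvPolynomial.pderiv j p) * y j) * y i = 0 := by
      rw [Finset.sum_mul]
      exact Finset.sum_eq_zero fun j _ => by rw [mul_assoc, hy, mul_zero]
    have h1 : ∑ j, MvPolynomial.aeval x (MvPolynomial.pderiv j (p * MvPolynomial.X i)) * y j =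
        MvPolynomial.aeval x p * y i +
        (∑ j, MvPolynomial.aeval x (MvPolynomial.pderiv j p) * y j) * x i := by
      rw [Finset.sum_mul]
      have : ∀ j, MvPolynomial.aeval x (MvPolynomial.pderiv j (p * MvPolynomial.X i)) * y j =
          (if j = i then MvPolynomial.aeval x p * y j else 0) +
          MvPolynomial.aeval x (MvPolynomial.pderiv j p) * y j * x i := by
        intro j
        rw [Derivation.leibniz]
        by_cases h : j = i
        · subst h
          simp [add_mul]
          ring
        · simp [MvPolynomial.pderiv_X_of_ne (Ne.symm h), h]
          ring
      rw [Finset.sum_congr rfl fun j _ => this j, Finset.sum_add_distrib]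
      simp
    rw [map_mul, hp, h1, map_mul, MvPolynomial.aeval_X, MvPolynomial.aeval_X]
    linear_combination h0

/-- If the Jacobian matrix of `G` is right invertible modulo the ideal `I` generated by `G`, then
the quotient by `I` is formally smooth. -/
theorem MvPolynomial.formallySmooth_quotient_of_jacobian {k σ ι : Type*} [CommRing k] [Fintype σ]
    [Fintype ι] [DecidableEq ι] (G : ι → MvPolynomial σ k)
    (M : σ → ι → MvPolynomial σ k)
    (hM : ∀ i l, (∑ j, MvPolynomial.pderiv j (G i) * M j l) - (if i = l then 1 else 0) ∈
      Ideal.span (Set.range G)) :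
    Algebra.FormallySmooth k (MvPolynomial σ k ⧸ Ideal.span (Set.range G)) := by
  set I := Ideal.span (Set.range G)
  let f := Ideal.Quotient.mkₐ k I
  have hker : RingHom.ker f.toRingHom = I := Ideal.mk_ker
  let q := Ideal.Quotient.mkₐ k (RingHom.ker f.toRingHom ^ 2)
  have hGI : ∀ i, G i ∈ I := fun i => Ideal.subset_span ⟨i, rfl⟩
  have hq : ∀ a ∈ I, ∀ b ∈ I, q a * q b = 0 := by
    intro a ha b hb
    rw [← map_mul]
    refine Ideal.Quotient.eq_zero_iff_mem.mpr ?_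
    rw [hker, pow_two]
    exact Ideal.mul_mem_mul ha hb
  let y : σ → _ := fun j => q (-∑ l, M j l * G l)
  have hyI : ∀ j, -∑ l, M j l * G l ∈ I := fun j =>
    I.neg_mem (I.sum_mem fun l _ => I.mul_mem_left _ (hGI l))
  let φ := MvPolynomial.aeval (R := k) (fun j => q (MvPolynomial.X j) + y j)
  have hqe : ∀ p, MvPolynomial.aeval (R := k) (fun j => q (MvPolynomial.X j)) p = q p := by
    intro p
    exact (MvPolynomial.comp_aeval_apply MvPolynomial.X q p).symm.trans
      (congrArg q (MvPolynomial.aeval_X_left_apply p))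
  have hφG : ∀ i, φ (G i) = 0 := by
    intro i
    have h1 := MvPolynomial.aeval_add_of_mul_eq_zero (fun j => q (MvPolynomial.X j)) y
      (fun a b => hq _ (hyI a) _ (hyI b)) (G i)
    simp only [hqe] at h1
    refine h1.trans ?_
    have h2 : ∑ j, q (MvPolynomial.pderiv j (G i)) * y j = -q (G i) := by
      have h3 : ∀ l, q (((∑ j, MvPolynomial.pderiv j (G i) * M j l) -
          (if i = l then 1 else 0)) * G l) = 0 := fun l => by
        rw [map_mul]; exact hq _ (hM i l) _ (hGI l)
      have h4 : ∑ l, q (((∑ j, MvPolynomial.pderiv j (G i) * M j l) -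
          (if i = l then 1 else 0)) * G l) = 0 := Finset.sum_eq_zero fun l _ => h3 l
      simp only [sub_mul, map_sub, Finset.sum_sub_distrib, ite_mul, one_mul, zero_mul,
        apply_ite q, map_zero, Finset.sum_ite_eq, Finset.mem_univ, if_true] at h4
      rw [sub_eq_zero] at h4
      rw [← h4]
      simp only [y, Finset.sum_mul, map_neg, map_sum, map_mul, mul_neg, Finset.mul_sum,
        Finset.sum_neg_distrib]
      rw [Finset.sum_comm]
      simp only [mul_assoc]
    rw [h2, add_neg_cancel]
  have hφI : ∀ a ∈ I, φ a = 0 := by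
    intro a ha
    have : I ≤ RingHom.ker φ := Ideal.span_le.mpr <| by
      rintro _ ⟨i, rfl⟩
      exact hφG i
    exact this ha
  refine Algebra.FormallySmooth.of_split f (Ideal.Quotient.liftₐ I φ hφI) ?_
  refine Ideal.Quotient.algHom_ext _ ?_
  refine MvPolynomial.algHom_ext fun j => ?_
  have : φ (MvPolynomial.X j) = q (MvPolynomial.X j - ∑ l, M j l * G l) := by
    simp only [φ, y, MvPolynomial.aeval_X, ← map_add, sub_eq_add_neg]
  change f.kerSquareLift (φ (MvPolynomial.X j)) = f (MvPolynomial.X j)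
  rw [this]
  change f (MvPolynomial.X j - ∑ l, M j l * G l) = f (MvPolynomial.X j)
  rw [map_sub, sub_eq_self]
  exact Ideal.Quotient.eq_zero_iff_mem.mpr (I.sum_mem fun l _ => I.mul_mem_left _ (hGI l))

/-- The Jacobian criterion: if the Jacobian matrix of finitely many polynomials over an algebraically
closed field is right invertible at each of their common zeros, then they generate a radical
ideal. -/
theorem MvPolynomial.isRadical_span_of_jacobian {k σ ι : Type*} [Field k] [IsAlgClosed k]
    [Fintype σ] [Fintype ι] [DecidableEq ι] (G : ι → MvPolynomial σ k)
    (hG : ∀ a : σ → k, (∀ i, MvPolynomial.eval a (G i) = 0) →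
      ∃ N : Matrix σ ι k, (Matrix.of fun i j =>
        MvPolynomial.eval a (MvPolynomial.pderiv j (G i))) * N = 1) :
    (Ideal.span (Set.range G)).IsRadical := by
  set I := Ideal.span (Set.range G)
  let Jac : Matrix ι σ (MvPolynomial σ k) :=
    Matrix.of fun i j => MvPolynomial.pderiv j (G i)
  let T : Ideal (MvPolynomial σ k) :=
    { carrier := {d | ∃ M : Matrix σ ι (MvPolynomial σ k), ∀ i l,
        (Jac * M) i l - (if i = l then d else 0) ∈ I}
      add_mem' := by
        rintro d e ⟨M, hM⟩ ⟨N, hN⟩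
        refine ⟨M + N, fun i l => ?_⟩
        have := I.add_mem (hM i l) (hN i l)
        rw [Matrix.mul_add, Matrix.add_apply]
        convert this using 1
        split_ifs <;> ring
      zero_mem' := ⟨0, fun i l => by simp⟩
      smul_mem' := by
        rintro c d ⟨M, hM⟩
        refine ⟨c • M, fun i l => ?_⟩
        have := I.mul_mem_left c (hM i l)
        rw [Matrix.mul_smul, Matrix.smul_apply, smul_eq_mul, smul_eq_mul]
        convert this using 1
        split_ifs <;> ring }
  have hIT : I ≤ T := fun d hd => ⟨0, fun i l => by
    rw [Matrix.mul_zero, Matrix.zero_apply, zero_sub]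
    split_ifs
    · exact I.neg_mem hd
    · simp⟩
  have hT : T = ⊤ := by
    by_contra hne
    obtain ⟨P, hP, hTP⟩ := Ideal.exists_le_maximal T hne
    obtain ⟨a, rfl⟩ := MvPolynomial.isMaximal_iff_eq_vanishingIdeal_singleton.mp hP
    obtain ⟨N, hN⟩ := hG a fun i => by
      have := hTP (hIT (Ideal.subset_span ⟨i, rfl⟩))
      rwa [MvPolynomial.mem_vanishingIdeal_singleton_iff, MvPolynomial.aeval_eq_eval] at this
    let NC : Matrix σ ι (MvPolynomial σ k) := N.map MvPolynomial.C
    have hdet : (Jac * NC).det ∈ T := by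
      refine ⟨NC * (Jac * NC).adjugate, fun i l => ?_⟩
      rw [← Matrix.mul_assoc, Matrix.mul_adjugate, Matrix.smul_apply, Matrix.one_apply]
      simp
    have h1 := hTP hdet
    rw [MvPolynomial.mem_vanishingIdeal_singleton_iff, MvPolynomial.aeval_eq_eval,
      RingHom.map_det] at h1
    have h2 : (MvPolynomial.eval a).mapMatrix (Jac * NC) = 1 := by
      rw [← hN]
      ext i l
      simp [Matrix.mul_apply, Jac, NC]
    rw [h2, Matrix.det_one] at h1
    exact one_ne_zero h1
  obtain ⟨M, hM⟩ : (1 : MvPolynomial σ k) ∈ T := hT ▸ Submodule.mem_top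
  have hsm : Algebra.FormallySmooth k (MvPolynomial σ k ⧸ I) :=
    MvPolynomial.formallySmooth_quotient_of_jacobian G M fun i l => by
      simpa [Matrix.mul_apply, Jac] using hM i l
  have hfp : Algebra.FinitePresentation k (MvPolynomial σ k ⧸ I) :=
    Algebra.FinitePresentation.quotient (Submodule.fg_span (Set.finite_range G))
  have : Algebra.Smooth k (MvPolynomial σ k ⧸ I) := ⟨hsm, hfp⟩
  exact (Ideal.isRadical_iff_quotient_reduced I).mpr (isReduced_of_smooth_field k _)

/-- Every maximal ideal of a polynomial ring in finitely many variables over an algebraically closed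
field has height equal to the number of variables. -/
theorem MvPolynomial.height_vanishingIdeal_singleton {k σ : Type*} [Field k] [IsAlgClosed k]
    [Finite σ] (a : σ → k) :
    (MvPolynomial.vanishingIdeal k {a}).height = Nat.card σ := by
  have hdim : ringKrullDim (MvPolynomial σ k) = Nat.card σ := by simp
  have : FiniteRingKrullDim (MvPolynomial σ k) := by
    rw [finiteRingKrullDim_iff_ne_bot_and_top, hdim]
    exact ⟨WithBot.coe_ne_bot, fun h => ENat.natCast_ne_top _ (WithBot.coe_injective h)⟩
  obtain ⟨P, hP, hPh⟩ := Ideal.exists_isMaximal_height (R := MvPolynomial σ k)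
  obtain ⟨b, rfl⟩ := MvPolynomial.isMaximal_iff_eq_vanishingIdeal_singleton.mp hP
  let τ : MvPolynomial σ k ≃ₐ[k] MvPolynomial σ k := AlgEquiv.ofAlgHom
    (MvPolynomial.aeval fun i => MvPolynomial.X i + MvPolynomial.C (a i - b i))
    (MvPolynomial.aeval fun i => MvPolynomial.X i - MvPolynomial.C (a i - b i))
    (MvPolynomial.algHom_ext fun i => by simp) (MvPolynomial.algHom_ext fun i => by simp)
  have hτ : (MvPolynomial.vanishingIdeal k {b}).comap τ.toRingEquiv =
      MvPolynomial.vanishingIdeal k {a} := by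
    ext p
    rw [Ideal.mem_comap, MvPolynomial.mem_vanishingIdeal_singleton_iff,
      MvPolynomial.mem_vanishingIdeal_singleton_iff]
    have : (MvPolynomial.aeval b).comp τ.toAlgHom = MvPolynomial.aeval (R := k) a :=
      MvPolynomial.algHom_ext fun i => by simp [τ]
    rw [← this]
    rfl
  rw [← hτ, RingEquiv.height_comap]
  exact WithBot.coe_injective (hPh.trans hdim)

/-- Let `I` be generated by `m` elements and contained in a prime `p`. If `t ∉ p` and
`t J ⊆ I ⊆ J ⊆ p`, then the height of `p` is at most the dimension of `R ⧸ J` plus `m`. -/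
theorem Ideal.height_le_ringKrullDim_quotient_add_card {R ι : Type*} [CommRing R]
    [IsNoetherianRing R] [Fintype ι] (G : ι → R) {J p : Ideal R} [p.IsPrime] (hJp : J ≤ p)
    {t : R} (ht : t ∉ p) (htJ : ∀ x ∈ J, t * x ∈ Ideal.span (Set.range G))
    (hGp : ∀ i, G i ∈ p) :
    (p.height : WithBot ℕ∞) ≤ ringKrullDim (R ⧸ J) + Fintype.card ι := by
  let p' := p.map (Ideal.Quotient.mk J)
  have hp' : p'.IsPrime := Ideal.isPrime_map_quotientMk_of_isPrime hJp
  obtain ⟨s, hps, hs⟩ := Ideal.exists_finset_card_eq_height_of_isNoetherianRing p'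
  have hsurj : Set.SurjOn (Ideal.Quotient.mk J) p s := by
    intro x hx
    obtain ⟨x, rfl⟩ := Ideal.Quotient.mk_surjective x
    refine ⟨x, ?_, rfl⟩
    have := hps.1.2 (Ideal.subset_span hx)
    simpa [p', hJp] using this
  obtain ⟨o, hop, ho, himgo⟩ := s.exists_subset_injOn_image_eq_of_surjOn (p : Set R) hsurj
  have hmin : p ∈ (J ⊔ Ideal.span (o : Set R)).minimalPrimes := by
    refine Ideal.mem_minimalPrimes_sup hJp ?_
    convert! hps
    simp [Ideal.map_span, ← himgo]
  have hmin' : p ∈ (Ideal.span ((o ∪ Finset.univ.image G : Finset R) : Set R)).minimalPrimes := by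
    refine ⟨⟨inferInstance, ?_⟩, ?_⟩
    · rw [Ideal.span_le]
      intro x hx
      simp only [Finset.coe_union, Finset.coe_image, Finset.coe_univ, Set.image_univ] at hx
      rcases hx with hx | ⟨i, rfl⟩
      · exact hop hx
      · exact hGp i
    · rintro q ⟨hq, hle⟩ hqp
      refine hmin.2 ⟨hq, sup_le ?_ ?_⟩ hqp
      · intro x hx
        have hGq : Ideal.span (Set.range G) ≤ q := by
          refine le_trans (Ideal.span_mono ?_) hle
          simp
        exact (hq.mem_or_mem (hGq (htJ x hx))).resolve_left fun h => ht (hqp h)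
      · exact le_trans (Ideal.span_mono (by simp)) hle
  have h1 := Ideal.height_le_card_of_mem_minimalPrimes_span_finset hmin'
  have h2 : ((o ∪ Finset.univ.image G).card : ℕ∞) ≤ p'.height + Fintype.card ι := by
    rw [← hs]
    have h3 : o.card = s.card := by
      rw [← himgo, Finset.card_image_of_injOn ho]
    have h4 : (Finset.univ.image G).card ≤ Fintype.card ι := Finset.card_image_le
    have h5 := Finset.card_union_le o (Finset.univ.image G)
    exact_mod_cast (by omega : (o ∪ Finset.univ.image G).card ≤ s.card + Fintype.card ι)
  calc (p.height : WithBot ℕ∞) ≤ ((p'.height + Fintype.card ι : ℕ∞) : WithBot ℕ∞) :=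
        WithBot.coe_le_coe.mpr (h1.trans h2)
    _ = (p'.height : WithBot ℕ∞) + Fintype.card ι := by push_cast; rfl
    _ ≤ _ := by
        gcongr
        exact Ideal.height_le_ringKrullDim_of_ne_top hp'.ne_top

/-- An alternant determinant `det (f_j (x_i))` is divisible by the Vandermonde determinant. -/
theorem Matrix.det_vandermonde_dvd_det_eval {R : Type*} [CommRing R] {n : ℕ} (x : Fin n → R)
    (f : Fin n → Polynomial R) :
    (Matrix.vandermonde x).det ∣ (Matrix.of fun i j => (f j).eval (x i)).det := by
  nontriviality R
  let P : Polynomial R := ∏ i, (Polynomial.X - Polynomial.C (x i))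
  have hP : P.Monic := Polynomial.monic_prod_of_monic _ _ fun i _ => Polynomial.monic_X_sub_C _
  have hdeg : P.natDegree = n := by simp [P]
  have hroot : ∀ i, P.eval (x i) = 0 := fun i => by
    rw [Polynomial.eval_prod]
    exact Finset.prod_eq_zero (Finset.mem_univ i) (by simp)
  have : (Matrix.of fun i j => (f j).eval (x i)) =
      Matrix.vandermonde x * Matrix.of fun (l j : Fin n) => (f j %ₘ P).coeff l := by
    ext i j
    have h1 : (f j).eval (x i) = (f j %ₘ P).eval (x i) := by
      conv_lhs => rw [← Polynomial.modByMonic_add_div (f j) P]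
      simp [hroot]
    have h2 : (f j %ₘ P).natDegree < n ∨ n = 0 := by
      rcases Nat.eq_zero_or_pos n with h | h
      · exact Or.inr h
      · left
        rw [← hdeg]
        refine Polynomial.natDegree_modByMonic_lt _ hP fun h1 => ?_
        rw [h1, Polynomial.natDegree_one] at hdeg
        omega
    have h2 := h2.resolve_right (by have := i.2; omega)
    rw [Matrix.of_apply, h1, Polynomial.eval_eq_sum_range' h2, Matrix.mul_apply,
      ← Fin.sum_univ_eq_sum_range (fun l => (f j %ₘ P).coeff l * x i ^ l)]
    exact Finset.sum_congr rfl fun l _ => by simp [mul_comm]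
  rw [this, Matrix.det_mul]
  exact Dvd.intro _ rfl

/-- The product of the differences `X_i - X_j` over `i < j`. -/
noncomputable def MvPolynomial.differenceProduct (n : ℕ) (k : Type*) [CommRing k] :
    MvPolynomial (Fin n) k :=
  ∏ i : Fin n, ∏ j ∈ Finset.Ioi i, (MvPolynomial.X i - MvPolynomial.X j)

theorem MvPolynomial.differenceProduct_eq_det (n : ℕ) (k : Type*) [CommRing k] :
    MvPolynomial.differenceProduct n k =
      (Matrix.vandermonde fun i => -(MvPolynomial.X i : MvPolynomial (Fin n) k)).det := by
  rw [Matrix.det_vandermonde, MvPolynomial.differenceProduct]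
  exact Finset.prod_congr rfl fun i _ => Finset.prod_congr rfl fun j _ => by ring

theorem MvPolynomial.rename_differenceProduct {n : ℕ} {k : Type*} [CommRing k]
    (σ : Equiv.Perm (Fin n)) :
    MvPolynomial.rename σ (MvPolynomial.differenceProduct n k) =
      ((Equiv.Perm.sign σ : ℤ) : MvPolynomial (Fin n) k) *
        MvPolynomial.differenceProduct n k := by
  rw [MvPolynomial.differenceProduct_eq_det, ← Matrix.det_permute, AlgHom.map_det]
  congr 1
  ext i j
  simp [Matrix.vandermonde_apply]

theorem MvPolynomial.differenceProduct_ne_zero (n : ℕ) (k : Type*) [CommRing k] [IsDomain k] :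
    MvPolynomial.differenceProduct n k ≠ 0 := by
  rw [MvPolynomial.differenceProduct_eq_det, Matrix.det_vandermonde_ne_zero_iff]
  exact neg_injective.comp (MvPolynomial.X_injective)

/-- The antisymmetrization of a polynomial. -/
noncomputable def MvPolynomial.antisymmetrization {n : ℕ} {k : Type*} [CommRing k]
    (g : MvPolynomial (Fin n) k) : MvPolynomial (Fin n) k :=
  ∑ σ : Equiv.Perm (Fin n), ((Equiv.Perm.sign σ : ℤ) : MvPolynomial (Fin n) k) *
    MvPolynomial.rename σ g

theorem MvPolynomial.rename_antisymmetrization {n : ℕ} {k : Type*} [CommRing k]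
    (τ : Equiv.Perm (Fin n)) (g : MvPolynomial (Fin n) k) :
    MvPolynomial.rename τ g.antisymmetrization =
      ((Equiv.Perm.sign τ : ℤ) : MvPolynomial (Fin n) k) * g.antisymmetrization := by
  rw [MvPolynomial.antisymmetrization, map_sum, Finset.mul_sum]
  refine Fintype.sum_equiv (Equiv.mulLeft τ) _ _ fun σ => ?_
  have h : ((Equiv.Perm.sign τ : ℤ) : MvPolynomial (Fin n) k) * (Equiv.Perm.sign τ : ℤ) = 1 := by
    rw [← Int.cast_mul, ← Units.val_mul, Int.units_mul_self, Units.val_one, Int.cast_one]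
  rw [map_mul, map_intCast, MvPolynomial.rename_rename, Equiv.coe_mulLeft, Equiv.Perm.sign_mul,
    Units.val_mul, Int.cast_mul, Equiv.Perm.coe_mul, ← mul_assoc, ← mul_assoc, h, one_mul]

theorem MvPolynomial.differenceProduct_dvd_antisymmetrization {n : ℕ} {k : Type*} [CommRing k]
    (g : MvPolynomial (Fin n) k) :
    MvPolynomial.differenceProduct n k ∣ g.antisymmetrization := by
  induction g using MvPolynomial.induction_on' with
  | monomial u a =>
    have h := Matrix.det_vandermonde_dvd_det_eval
      (fun i => -(MvPolynomial.X i : MvPolynomial (Fin n) k))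
      (fun j => (-Polynomial.X) ^ u j)
    rw [← MvPolynomial.differenceProduct_eq_det] at h
    have h2 : (MvPolynomial.monomial u a).antisymmetrization = MvPolynomial.C a *
        (Matrix.of fun i j => ((-Polynomial.X) ^ u j : Polynomial (MvPolynomial (Fin n) k)).eval
          (-(MvPolynomial.X i : MvPolynomial (Fin n) k))).det := by
      rw [Matrix.det_apply', MvPolynomial.antisymmetrization, Finset.mul_sum]
      refine Finset.sum_congr rfl fun σ _ => ?_
      rw [MvPolynomial.monomial_eq, map_mul, MvPolynomial.rename_C,
        Finsupp.prod_fintype _ _ (by simp), map_prod]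
      simp only [map_pow, MvPolynomial.rename_X, Matrix.of_apply, Polynomial.eval_pow,
        Polynomial.eval_neg, Polynomial.eval_X, neg_neg]
      ring
    rw [h2]
    exact h.mul_left _
  | add p q hp hq =>
    have : (p + q).antisymmetrization = p.antisymmetrization + q.antisymmetrization := by
      simp [MvPolynomial.antisymmetrization, mul_add, Finset.sum_add_distrib]
    rw [this]
    exact dvd_add hp hq

/-- The antisymmetrization of a polynomial is a symmetric multiple of the product of
differences. -/
theorem MvPolynomial.exists_isSymmetric_antisymmetrization {n : ℕ} {k : Type*} [CommRing k]
    [IsDomain k] (g : MvPolynomial (Fin n) k) :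
    ∃ s : MvPolynomial (Fin n) k, s.IsSymmetric ∧
      g.antisymmetrization = MvPolynomial.differenceProduct n k * s := by
  obtain ⟨s, hs⟩ := MvPolynomial.differenceProduct_dvd_antisymmetrization g
  refine ⟨s, fun τ => ?_, hs⟩
  have h := MvPolynomial.rename_antisymmetrization τ g
  rw [hs, map_mul, MvPolynomial.rename_differenceProduct, mul_assoc] at h
  have hu : IsUnit ((Equiv.Perm.sign τ : ℤ) : MvPolynomial (Fin n) k) :=
    (Units.isUnit (Equiv.Perm.sign τ)).map (Int.castRingHom (MvPolynomial (Fin n) k))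
  exact mul_left_cancel₀ (MvPolynomial.differenceProduct_ne_zero n k) (hu.mul_left_cancel h)

/-- The polynomial ring is generated by finitely many elements over the symmetric polynomials, with
coefficients given by antisymmetrizations. -/
theorem MvPolynomial.exists_dual_generators (n : ℕ) (k : Type*) [CommRing k] :
    ∃ (ι : Type) (_ : Fintype ι) (u v : ι → MvPolynomial (Fin n) k),
      ∀ g : MvPolynomial (Fin n) k, MvPolynomial.differenceProduct n k * g =
        ∑ α, v α * (u α * g).antisymmetrization := by
  let P : Finset (Σ _ : Fin n, Fin n) := Finset.univ.sigma fun i => Finset.Ioi i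
  let u : Finset (Σ _ : Fin n, Fin n) → MvPolynomial (Fin n) k :=
    fun t => ∏ e ∈ t, MvPolynomial.X e.1
  let v : Finset (Σ _ : Fin n, Fin n) → MvPolynomial (Fin n) k :=
    fun t => ∏ e ∈ P \ t, -MvPolynomial.X e.2
  have key : ∀ σ : Equiv.Perm (Fin n), ∑ t ∈ P.powerset, MvPolynomial.rename σ (u t) * v t =
      if σ = 1 then MvPolynomial.differenceProduct n k else 0 := by
    intro σ
    have h1 : ∑ t ∈ P.powerset, MvPolynomial.rename σ (u t) * v t =
        ∏ e ∈ P, (MvPolynomial.X (σ e.1) - MvPolynomial.X e.2) := by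
      simp only [sub_eq_add_neg, Finset.prod_add, u, v, map_prod, MvPolynomial.rename_X]
    rw [h1]
    split_ifs with h
    · subst h
      rw [Finset.prod_sigma]
      rfl
    · obtain ⟨i, hi⟩ : ∃ i, i < σ i := by
        by_contra! hle
        have hsum := (Finset.sum_eq_sum_iff_of_le (s := Finset.univ)
          (f := fun i => (σ i : ℕ)) (g := fun i : Fin n => (i : ℕ)) fun i _ => hle i).mp
          (Equiv.sum_comp σ fun i => (i : ℕ))
        exact h (Equiv.ext fun i => Fin.ext (hsum i (Finset.mem_univ i)))
      exact Finset.prod_eq_zero (i := ⟨i, σ i⟩) (by simp [P, hi]) (sub_self _)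
  refine ⟨P.powerset, inferInstance, fun t => u t, fun t => v t, fun g => ?_⟩
  rw [Finset.sum_coe_sort P.powerset fun t => v t * (u t * g).antisymmetrization]
  simp only [MvPolynomial.antisymmetrization, map_mul, Finset.mul_sum]
  rw [Finset.sum_comm]
  have : ∀ σ : Equiv.Perm (Fin n), ∑ t ∈ P.powerset,
      v t * (((Equiv.Perm.sign σ : ℤ) : MvPolynomial (Fin n) k) *
        (MvPolynomial.rename σ (u t) * MvPolynomial.rename σ g)) =
      ((Equiv.Perm.sign σ : ℤ) : MvPolynomial (Fin n) k) * MvPolynomial.rename σ g *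
        if σ = 1 then MvPolynomial.differenceProduct n k else 0 := by
    intro σ
    rw [← key, Finset.mul_sum]
    exact Finset.sum_congr rfl fun t _ => by ring
  rw [Finset.sum_congr rfl fun σ _ => this σ]
  simp [mul_comm]

/-- The homomorphism sending the `j`-th variable to the coefficient of `T ^ j` in the generic monic
split polynomial `∏ (T - X_i)`. -/
noncomputable def MvPolynomial.coeffHom (r : ℕ) (k : Type*) [CommRing k] :
    MvPolynomial (Fin r) k →ₐ[k] MvPolynomial (Fin r) k :=
  MvPolynomial.aeval fun j => (-1) ^ (r - (j : ℕ)) * MvPolynomial.esymm (Fin r) k (r - (j : ℕ))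

theorem MvPolynomial.isSymmetric_coeffHom {r : ℕ} {k : Type*} [CommRing k]
    (b : MvPolynomial (Fin r) k) : (MvPolynomial.coeffHom r k b).IsSymmetric := by
  intro σ
  have : (MvPolynomial.rename σ).comp (MvPolynomial.coeffHom r k) = MvPolynomial.coeffHom r k :=
    MvPolynomial.algHom_ext fun j => by
      simp [MvPolynomial.coeffHom, MvPolynomial.rename_esymm]
  exact DFunLike.congr_fun this b

theorem MvPolynomial.IsSymmetric.exists_coeffHom_eq {r : ℕ} {k : Type*} [CommRing k]
    {p : MvPolynomial (Fin r) k} (hp : p.IsSymmetric) :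
    ∃ b, MvPolynomial.coeffHom r k b = p := by
  obtain ⟨q, hq⟩ := MvPolynomial.esymmAlgHom_surjective (σ := Fin r) (n := r) k (by simp) ⟨p, hp⟩
  replace hq : MvPolynomial.aeval (fun i : Fin r => MvPolynomial.esymm (Fin r) k (i + 1)) q = p := by
    rw [← MvPolynomial.esymmAlgHom_apply, hq]
  refine ⟨MvPolynomial.aeval
    (fun i : Fin r => (-1) ^ ((i : ℕ) + 1) * MvPolynomial.X (Fin.rev i)) q, ?_⟩
  rw [← AlgHom.comp_apply, ← hq]
  refine DFunLike.congr_fun (MvPolynomial.algHom_ext fun i => ?_) q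
  have hi : r - (Fin.rev i : ℕ) = i + 1 := by rw [Fin.val_rev]; omega
  simp only [AlgHom.comp_apply, MvPolynomial.aeval_X, map_mul, map_pow, map_neg, map_one,
    MvPolynomial.coeffHom, hi]
  rw [← mul_assoc, ← mul_pow]
  simp

theorem monicOfCoeffs_coeff {k : Type*} [CommRing k] (r : ℕ) (a : Fin r → k) (j : Fin r) :
    (monicOfCoeffs r a).coeff j = a j := by
  have h : ∀ i : Fin r, ((j : ℕ) = i) = (i = j) := fun i => by
    rw [eq_iff_iff, Fin.ext_iff, eq_comm]
  simp [monicOfCoeffs, Polynomial.coeff_X_pow, j.2.ne, h]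

theorem monicOfCoeffs_monic_natDegree {k : Type*} [CommRing k] [Nontrivial k] (r : ℕ)
    (a : Fin r → k) : (monicOfCoeffs r a).Monic ∧ (monicOfCoeffs r a).natDegree = r := by
  have h : (∑ j : Fin r, Polynomial.C (a j) * Polynomial.X ^ (j : ℕ)).degree < (r : WithBot ℕ) := by
    refine lt_of_le_of_lt (Polynomial.degree_sum_le _ _) ?_
    refine (Finset.sup_lt_iff (WithBot.bot_lt_coe r)).mpr fun j _ => ?_
    exact lt_of_le_of_lt (Polynomial.degree_C_mul_X_pow_le _ _) (WithBot.coe_lt_coe.mpr j.2)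
  refine ⟨Polynomial.monic_X_pow_add h, ?_⟩
  refine Polynomial.natDegree_eq_of_degree_eq_some ?_
  rw [monicOfCoeffs, Polynomial.degree_add_eq_left_of_degree_lt] <;>
    rw [Polynomial.degree_X_pow]
  exact h

theorem exists_monicOfCoeffs_eq_prod {k : Type*} [Field k] [IsAlgClosed k] (r : ℕ)
    (a : Fin r → k) :
    ∃ x : Fin r → k, monicOfCoeffs r a = ∏ i, (Polynomial.X - Polynomial.C (x i)) := by
  obtain ⟨hmonic, hdeg⟩ := monicOfCoeffs_monic_natDegree r a
  have hs := IsAlgClosed.splits (monicOfCoeffs r a)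
  have hcard : (monicOfCoeffs r a).roots.card = r := by
    rw [← hs.natDegree_eq_card_roots, hdeg]
  have hprod := hs.eq_prod_roots_of_monic hmonic
  obtain ⟨l, hl⟩ := Quot.exists_rep (monicOfCoeffs r a).roots
  change (l : Multiset k) = _ at hl
  rw [← hl, Multiset.coe_card] at hcard
  refine ⟨fun i => l.get (i.cast hcard.symm), ?_⟩
  rw [hprod, ← hl, Multiset.map_coe, Multiset.prod_coe, ← List.prod_ofFn]
  congr 1
  subst hcard
  conv_lhs => rw [← List.ofFn_get l, List.map_ofFn]
  rfl

theorem eval_coeffHom_of_monicOfCoeffs_eq_prod {k : Type*} [CommRing k] {r : ℕ}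
    {a x : Fin r → k} (h : monicOfCoeffs r a = ∏ i, (Polynomial.X - Polynomial.C (x i)))
    (b : MvPolynomial (Fin r) k) :
    MvPolynomial.eval x (MvPolynomial.coeffHom r k b) = MvPolynomial.eval a b := by
  have : (MvPolynomial.aeval x).comp (MvPolynomial.coeffHom r k) = MvPolynomial.aeval (R := k) a :=
    MvPolynomial.algHom_ext fun j => by
      have hc := Finset.prod_X_add_C_coeff Finset.univ (fun i => -x i) (k := (j : ℕ))
        (by simp)
      simp only [map_neg, ← sub_eq_add_neg] at hc
      rw [← h, monicOfCoeffs_coeff] at hc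
      simp only [MvPolynomial.coeffHom, AlgHom.comp_apply, MvPolynomial.aeval_X, map_mul, map_pow,
        map_neg, map_one, hc, MvPolynomial.esymm, map_sum, map_prod, Finset.mul_sum,
        Finset.card_univ, Fintype.card_fin]
      refine Finset.sum_congr rfl fun t ht => ?_
      rw [Finset.prod_neg, (Finset.mem_powersetCard.mp ht).2]
  simpa [MvPolynomial.aeval_eq_eval] using DFunLike.congr_fun this b

theorem injective_of_squarefree_prod_X_sub_C {k : Type*} [Field k] {r : ℕ} {x : Fin r → k}
    (h : Squarefree (∏ i, (Polynomial.X - Polynomial.C (x i)))) : Function.Injective x := by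
  intro i j hij
  by_contra hne
  refine Polynomial.not_isUnit_X_sub_C (x i) (h _ ?_)
  rw [← Finset.mul_prod_erase _ _ (Finset.mem_univ i)]
  refine mul_dvd_mul_left _ ?_
  rw [hij]
  exact Finset.dvd_prod_of_mem (fun i => Polynomial.X - Polynomial.C (x i)) (by simp [Ne.symm hne])

theorem MvPolynomial.eval_differenceProduct_ne_zero {k : Type*} [CommRing k] [IsDomain k] {r : ℕ}
    {x : Fin r → k} (h : Function.Injective x) :
    MvPolynomial.eval x (MvPolynomial.differenceProduct r k) ≠ 0 := by
  rw [MvPolynomial.differenceProduct, map_prod, Finset.prod_ne_zero_iff]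
  intro i _
  rw [map_prod, Finset.prod_ne_zero_iff]
  intro j hj
  simpa [sub_eq_zero] using h.ne (Finset.mem_Ioi.mp hj).ne

/-- Let `Z` be a subset of the zero locus of `m` polynomials generating a radical ideal. If the
dimension of `Z` is less than `r - m`, then the ideal contains each polynomial vanishing at the
common zeros outside `Z`. -/
theorem mem_span_of_eval_eq_zero_of_dimOf_lt {k : Type*} [Field k] [IsAlgClosed k] {r m : ℕ}
    (hmr : m ≤ r) (G : Fin m → MvPolynomial (Fin r) k)
    (hG : (Ideal.span (Set.range G)).IsRadical) (Z : Set (Fin r → k))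
    (hZ : dimOf k r Z + 1 ≤ ((r - m : ℕ) : WithBot ℕ∞)) {b : MvPolynomial (Fin r) k}
    (hb : ∀ a, (∀ i, MvPolynomial.eval a (G i) = 0) → a ∉ Z → MvPolynomial.eval a b = 0) :
    b ∈ Ideal.span (Set.range G) := by
  have hI : ∀ p : MvPolynomial (Fin r) k,
      (∀ a, (∀ i, MvPolynomial.eval a (G i) = 0) → MvPolynomial.eval a p = 0) →
        p ∈ Ideal.span (Set.range G) := by
    intro p hp
    rw [← hG.radical, ← MvPolynomial.vanishingIdeal_zeroLocus_eq_radical (K := k),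
      MvPolynomial.zeroLocus_span]
    intro a ha
    rw [MvPolynomial.aeval_eq_eval]
    exact hp a fun i => by simpa [MvPolynomial.aeval_eq_eval] using ha (G i) ⟨i, rfl⟩
  refine hI b fun a ha => ?_
  by_contra hab
  have haZ : a ∈ Z := by
    by_contra h
    exact hab (hb a ha h)
  have hmem : ∀ p, p ∈ MvPolynomial.vanishingIdeal k {a} ↔ MvPolynomial.eval a p = 0 := fun p => by
    rw [MvPolynomial.mem_vanishingIdeal_singleton_iff, MvPolynomial.aeval_eq_eval]
  have : (MvPolynomial.vanishingIdeal k {a}).IsPrime :=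
    (MvPolynomial.isMaximal_iff_eq_vanishingIdeal_singleton.mpr ⟨a, rfl⟩).isPrime
  have hle := Ideal.height_le_ringKrullDim_quotient_add_card G
    (J := vanishingIdealOf k r Z) (p := MvPolynomial.vanishingIdeal k {a}) (t := b)
    (fun p hp => (hmem p).mpr (hp a haZ)) (fun h => hab ((hmem b).mp h))
    (fun p hp => hI _ fun c hc => by
      rw [map_mul]
      by_cases hcZ : c ∈ Z
      · rw [hp c hcZ, mul_zero]
      · rw [hb c hc hcZ, zero_mul])
    fun i => (hmem _).mpr (ha i)
  rw [MvPolynomial.height_vanishingIdeal_singleton, Nat.card_fin, Fintype.card_fin] at hle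
  change _ ≤ dimOf k r Z + _ at hle
  generalize dimOf k r Z = d at hle hZ
  induction d with
  | bot =>
    rw [WithBot.bot_add] at hle
    exact WithBot.coe_ne_bot (le_bot_iff.mp hle)
  | coe d =>
    induction d with
    | top => exact absurd (WithBot.coe_le_coe.mp hZ) (by simp)
    | coe d =>
      have h1 : d + 1 ≤ r - m := by
        have h : (d : ℕ∞) + 1 ≤ (r - m : ℕ) := WithBot.coe_le_coe.mp hZ
        exact (Nat.cast_le (α := ℕ∞)).mp (by rwa [Nat.cast_succ])
      have h2 : r ≤ d + m := by
        have h : (r : ℕ∞) ≤ d + m := WithBot.coe_le_coe.mp hle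
        exact_mod_cast h
      omega

/-- If the polynomials lying in the ideal generated by the `G_i` can be detected at the common zeros
whose associated monic polynomial is squarefree, then the images of the `G_i` under `coeffHom`
generate a radical ideal. -/
theorem isRadical_span_coeffHom {k ι : Type*} [Field k] [IsAlgClosed k] {r : ℕ}
    (G : ι → MvPolynomial (Fin r) k)
    (hG : ∀ b, (∀ a, (∀ i, MvPolynomial.eval a (G i) = 0) → Squarefree (monicOfCoeffs r a) →
      MvPolynomial.eval a b = 0) → b ∈ Ideal.span (Set.range G)) :
    (Ideal.span (Set.range fun i => MvPolynomial.coeffHom r k (G i))).IsRadical := by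
  rintro g ⟨n, hg⟩
  have hzero : ∀ x, (∀ i, MvPolynomial.eval x (MvPolynomial.coeffHom r k (G i)) = 0) →
      MvPolynomial.eval x g = 0 := by
    intro x hx
    have hle : Ideal.span (Set.range fun i => MvPolynomial.coeffHom r k (G i)) ≤
        RingHom.ker (MvPolynomial.eval x) := by
      rw [Ideal.span_le]
      rintro _ ⟨i, rfl⟩
      exact hx i
    have h := hle hg
    rw [RingHom.mem_ker, map_pow] at h
    exact eq_zero_of_pow_eq_zero h
  obtain ⟨A, _, u, v, huv⟩ := MvPolynomial.exists_dual_generators r k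
  have hs : ∀ α, ∃ s ∈ Ideal.span (Set.range fun i => MvPolynomial.coeffHom r k (G i)),
      (u α * g).antisymmetrization = MvPolynomial.differenceProduct r k * s := by
    intro α
    obtain ⟨s, hsymm, hs⟩ := MvPolynomial.exists_isSymmetric_antisymmetrization (u α * g)
    obtain ⟨b, rfl⟩ := hsymm.exists_coeffHom_eq
    refine ⟨_, ?_, hs⟩
    have hb : b ∈ Ideal.span (Set.range G) := by
      refine hG b fun a ha hsq => ?_
      obtain ⟨x, hx⟩ := exists_monicOfCoeffs_eq_prod r a
      rw [← eval_coeffHom_of_monicOfCoeffs_eq_prod hx]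
      have hinj := injective_of_squarefree_prod_X_sub_C (hx ▸ hsq)
      refine (mul_eq_zero.mp ?_).resolve_left (MvPolynomial.eval_differenceProduct_ne_zero hinj)
      rw [← map_mul, ← hs, MvPolynomial.antisymmetrization, map_sum]
      refine Finset.sum_eq_zero fun σ _ => ?_
      rw [map_mul, MvPolynomial.eval_rename, map_mul, hzero (x ∘ σ), mul_zero, mul_zero]
      intro i
      rw [← MvPolynomial.eval_rename, MvPolynomial.isSymmetric_coeffHom,
        eval_coeffHom_of_monicOfCoeffs_eq_prod hx, ha i]
    have := Ideal.mem_map_of_mem (MvPolynomial.coeffHom r k) hb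
    rwa [Ideal.map_span, ← Set.range_comp] at this
  choose s hsmem hs using hs
  have : g = ∑ α, v α * s α := by
    refine mul_left_cancel₀ (MvPolynomial.differenceProduct_ne_zero r k) ?_
    rw [huv g, Finset.mul_sum]
    exact Finset.sum_congr rfl fun α _ => by rw [hs]; ring
  rw [this]
  exact Ideal.sum_mem _ fun α _ => Ideal.mul_mem_left _ _ (hsmem α)

/-- A matrix over a field whose rank is the number of its rows has a right inverse. -/
theorem Matrix.exists_mul_eq_one_of_rank_eq {k m n : Type*} [Field k] [Fintype m] [Fintype n]
    [DecidableEq m] (A : Matrix m n k) (hA : A.rank = Fintype.card m) :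
    ∃ B : Matrix n m k, A * B = 1 := by
  rw [← Matrix.mulVec_surjective_iff_exists_right_inverse]
  have : LinearMap.range A.mulVecLin = ⊤ :=
    Submodule.eq_top_of_finrank_eq (by rw [← Matrix.rank, hA, Module.finrank_fintype_fun_eq_card])
  exact LinearMap.range_eq_top.mp this

/-- Under hypotheses (H1), (H2), (H4) and (H5), the ideal generated by `R_1, …, R_m` in
`K[X_1, …, X_r]` is a radical ideal. -/
theorem substituted_polynomials_define_radical_ideal
    (Fq K : Type) [Field Fq] [Fintype Fq] [Field K] [Algebra Fq K] [IsAlgClosure Fq K]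
    (r m : ℕ) (hm : 1 ≤ m) (hmr : m < r) (k : Fin r)
    (G : Fin m → MvPolynomial {j : Fin r // j ≠ k} Fq)
    -- the variety `W ⊆ K^r` of common zeros of `G_1, …, G_m`
    (W : Set (Fin r → K))
    (hW : W = {a | ∀ i, MvPolynomial.eval (fun j : {j : Fin r // j ≠ k} => a j.1)
        (MvPolynomial.map (algebraMap Fq K) (G i)) = 0})
    -- (H1): `G_1, …, G_m` form a regular sequence
    (hH1 : RingTheory.Sequence.IsRegular (MvPolynomial {j : Fin r // j ≠ k} Fq) (List.ofFn G))
    -- (H2): the Jacobian of `G_1, …, G_m` has full rank `m` at every point of `W`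
    (hH2 : ∀ a ∈ W, Matrix.rank (Matrix.of fun (i : Fin m) (j : {j : Fin r // j ≠ k}) =>
        MvPolynomial.eval (fun j' : {j : Fin r // j ≠ k} => a j'.1)
          (MvPolynomial.pderiv j (MvPolynomial.map (algebraMap Fq K) (G i)))) = m)
    -- (H4): the non-squarefree locus in `W` has dimension at most `r - m - 1`
    (hH4 : dimOf K r {a | a ∈ W ∧ ¬ Squarefree (monicOfCoeffs r a)} + 1
        ≤ ((r - m : ℕ) : WithBot ℕ∞))
    -- (H5): dimension at most `r - m - 2`
    (hH5 : dimOf K r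
        ({a | a ∈ W ∧ ¬ Squarefree (monicOfCoeffs r a)
            ∧ a ⟨0, lt_of_le_of_lt (Nat.zero_le m) hmr⟩ = 0}
          ∪ {a | a ∈ W ∧ 2 ≤ (EuclideanDomain.gcd (monicOfCoeffs r a)
              (Polynomial.derivative (monicOfCoeffs r a))).degree}) + 2
        ≤ ((r - m : ℕ) : WithBot ℕ∞))
    -- the polynomials `R_i`, obtained from `G_i` by substituting `(-1)^(r-j) Π_(r-j)` for `A_j`
    (R : Fin m → MvPolynomial (Fin r) Fq)
    (hR : ∀ i, R i = MvPolynomial.aeval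
        (fun j : {j : Fin r // j ≠ k} =>
          (-1 : MvPolynomial (Fin r) Fq) ^ (r - (j.1 : ℕ))
            * MvPolynomial.esymm (Fin r) Fq (r - (j.1 : ℕ))) (G i))
 :
    (Ideal.span (Set.range fun i =>
        MvPolynomial.map (algebraMap Fq K) (R i))).IsRadical := by
  have : IsAlgClosed K := IsAlgClosure.isAlgClosed Fq
  let G' : Fin m → MvPolynomial (Fin r) K := fun i =>
    MvPolynomial.rename Subtype.val (MvPolynomial.map (algebraMap Fq K) (G i))
  have heval : ∀ (a : Fin r → K) (p : MvPolynomial {j : Fin r // j ≠ k} K),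
      MvPolynomial.eval a (MvPolynomial.rename Subtype.val p) =
        MvPolynomial.eval (fun j : {j : Fin r // j ≠ k} => a j.1) p := fun a p =>
    MvPolynomial.eval_rename _ _ _
  have hW' : ∀ a, a ∈ W ↔ ∀ i, MvPolynomial.eval a (G' i) = 0 := fun a => by
    simp only [hW, G', heval, Set.mem_ofPred_eq]
  have hrad : (Ideal.span (Set.range G')).IsRadical := by
    refine MvPolynomial.isRadical_span_of_jacobian G' fun a ha => ?_
    obtain ⟨B, hB⟩ := Matrix.exists_mul_eq_one_of_rank_eq _
      ((hH2 a ((hW' a).mpr ha)).trans (Fintype.card_fin m).symm)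
    refine ⟨Matrix.of fun j i => if h : j ≠ k then B ⟨j, h⟩ i else 0, ?_⟩
    rw [← hB]
    ext i l
    rw [Matrix.mul_apply, Matrix.mul_apply, Fintype.sum_eq_add_sum_subtype_ne _ k]
    simp only [Matrix.of_apply, ne_eq, not_true_eq_false, dite_false, mul_zero, zero_add]
    refine Finset.sum_congr rfl fun j _ => ?_
    rw [dif_pos j.2, MvPolynomial.pderiv_rename Subtype.val_injective, heval]
  have hmain := isRadical_span_coeffHom G' fun b hb =>
    mem_span_of_eval_eq_zero_of_dimOf_lt hmr.le G' hrad _ hH4 fun a ha haZ =>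
      hb a ha (by_contra fun h => haZ ⟨(hW' a).mpr ha, h⟩)
  convert hmain using 4 with i
  rw [hR, MvPolynomial.coeffHom, MvPolynomial.aeval_rename]
  rw [MvPolynomial.aeval_def, MvPolynomial.eval₂_comp_left, MvPolynomial.aeval_map_algebraMap]
  rw [MvPolynomial.aeval_def]
  congr 1
  · exact RingHom.ext fun c => MvPolynomial.map_C _ c
  · funext j
    simp [MvPolynomial.map_esymm]
end
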